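/- Let (α,θ) ∈ Ω with θ ≠ 0 and let φ, β, G be as in the context. Fix c ∈ ℝ and define A_c, y₁, y₃ as in the context. Then for all u ∈ ℝ: y₁'(u) = ((C² + G'(u)²)/C)·cos φ(u)·cosh A_c(u) and y₃'(u) = −((C² + G'(u)²)/C)·sin φ(u)·cosh A_c(u). -/

import Mathlib

open Real Filter

noncomputable def Ccoef (α θ : ℝ) : ℝ := Real.sin (2 * θ) / (2 * α)

noncomputable def Ppoly (α θ x : ℝ) : ℝ :=
  α ^ 2 + Real.cos (2 * θ) * x ^ 2 - Ccoef α θ ^ 2 * x ^ 4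

noncomputable def thetaPlus (α : ℝ) : ℝ :=
  if 1 < α then Real.pi / 2 else (1 / 2) * Real.arccos (1 - 2 * α ^ 2)

def inOmega (α θ : ℝ) : Prop := 0 < α ∧ -thetaPlus α < θ ∧ θ < thetaPlus α

noncomputable def Lint (α θ : ℝ) : ℝ :=
  ∫ x in (-1 : ℝ)..1,
    (2 * α * Ccoef α θ ^ 2 * x ^ 2 - α * Real.cos (2 * θ)
        + Ccoef α θ ^ 2 * x ^ 2 * Real.sqrt (Ppoly α θ x)) /
      (Real.sqrt ((1 - x ^ 2) * Ppoly α θ x) * (α + Real.sqrt (Ppoly α θ x)))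

/-- Wirtinger derivative `f_z = (f_u - i f_v)/2` of a map `f : ℝ² → ℂ`. -/
noncomputable def wz (f : ℝ × ℝ → ℂ) (p : ℝ × ℝ) : ℂ :=
  (deriv (fun t => f (t, p.2)) p.1 - Complex.I * deriv (fun t => f (p.1, t)) p.2) / 2

/-- Wirtinger derivative `f_z̄ = (f_u + i f_v)/2` of a map `f : ℝ² → ℂ`. -/
noncomputable def wzbar (f : ℝ × ℝ → ℂ) (p : ℝ × ℝ) : ℂ :=
  (deriv (fun t => f (t, p.2)) p.1 + Complex.I * deriv (fun t => f (p.1, t)) p.2) / 2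

theorem cos_two_mul_lt_of_inOmega {α θ : ℝ} (hΩ : inOmega α θ) (hα : α ≤ 1) :
    1 - 2 * α ^ 2 < Real.cos (2 * θ) := by
  obtain ⟨hα0, h1, h2⟩ := hΩ
  rw [thetaPlus, if_neg (not_lt.mpr hα)] at h1 h2
  have habs : |2 * θ| < Real.arccos (1 - 2 * α ^ 2) := abs_lt.mpr ⟨by linarith, by linarith⟩
  have := Real.cos_lt_cos_of_nonneg_of_le_pi (abs_nonneg _) (Real.arccos_le_pi _) habs
  rwa [Real.cos_arccos (by nlinarith) (by nlinarith), Real.cos_abs] at this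

theorem sin_sq_lt_of_inOmega {α θ : ℝ} (hΩ : inOmega α θ) : Real.sin θ ^ 2 < α ^ 2 := by
  rcases lt_or_ge 1 α with h | h
  · nlinarith [Real.sin_sq_le_one θ]
  · have := cos_two_mul_lt_of_inOmega hΩ h
    rw [Real.cos_two_mul, Real.cos_sq'] at this
    linarith

theorem thetaPlus_le (α : ℝ) : thetaPlus α ≤ Real.pi / 2 := by
  unfold thetaPlus
  split_ifs
  · exact le_rfl
  · linarith [Real.arccos_le_pi (1 - 2 * α ^ 2)]

theorem Ccoef_ne_zero {α θ : ℝ} (hΩ : inOmega α θ) (hθ : θ ≠ 0) : Ccoef α θ ≠ 0 := by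
  obtain ⟨hα, h1, h2⟩ := hΩ
  have hle := thetaPlus_le α
  refine div_ne_zero ?_ (by positivity)
  rw [Ne, Real.sin_eq_zero_iff_of_lt_of_lt (by linarith) (by linarith)]
  simpa using hθ

theorem Ppoly_eq_mul {α : ℝ} (hα : α ≠ 0) (θ x : ℝ) :
    Ppoly α θ x =
      (α ^ 2 - Real.sin θ ^ 2 * x ^ 2) * (1 + Real.cos θ ^ 2 * x ^ 2 / α ^ 2) := by
  rw [Ppoly, Ccoef, Real.sin_two_mul, Real.cos_two_mul']
  field_simp
  ring

theorem Ppoly_pos {α θ x : ℝ} (hΩ : inOmega α θ) (hx : x ^ 2 ≤ 1) : 0 < Ppoly α θ x := by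
  rw [Ppoly_eq_mul hΩ.1.ne']
  refine mul_pos ?_ (by positivity)
  nlinarith [sin_sq_lt_of_inOmega hΩ, sq_nonneg (Real.sin θ)]

theorem hasDerivAt_Ppoly (α θ x : ℝ) :
    HasDerivAt (Ppoly α θ) (2 * Real.cos (2 * θ) * x - 4 * Ccoef α θ ^ 2 * x ^ 3) x := by
  have h := (((hasDerivAt_pow 2 x).const_mul (Real.cos (2 * θ))).const_add (α ^ 2)).sub
    ((hasDerivAt_pow 4 x).const_mul (Ccoef α θ ^ 2))
  refine h.congr_deriv ?_
  norm_num
  ring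

/-- A continuous nowhere vanishing function that is nonpositive at one point is negative. -/
theorem neg_of_continuous_of_ne_zero {f : ℝ → ℝ} (hf : Continuous f) (hne : ∀ u, f u ≠ 0)
    {a : ℝ} (ha : f a ≤ 0) (u : ℝ) : f u < 0 := by
  by_contra! h
  obtain ⟨v, hv⟩ := mem_range_of_exists_le_of_exists_ge hf ⟨a, ha⟩ ⟨u, h⟩
  exact hne v hv

/-- The second order equation satisfied by a solution of `φ'² = P(cos φ)` with `φ' < 0`. -/
theorem hasDerivAt_deriv_of_ode {α θ : ℝ} {φ φ' : ℝ → ℝ} (hφ : ∀ u, HasDerivAt φ (φ' u) u)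
    (hode : ∀ u, φ' u ^ 2 = Ppoly α θ (Real.cos (φ u))) (hneg : ∀ u, φ' u < 0) (u : ℝ) :
    HasDerivAt φ' (Real.sin (φ u) * Real.cos (φ u) *
      (2 * Ccoef α θ ^ 2 * Real.cos (φ u) ^ 2 - Real.cos (2 * θ))) u := by
  have hsqrt : φ' = fun v => -Real.sqrt (Ppoly α θ (Real.cos (φ v))) := by
    funext v
    rw [← hode, Real.sqrt_sq_eq_abs, abs_of_neg (hneg v), neg_neg]
  have hP : Ppoly α θ (Real.cos (φ u)) ≠ 0 := by
    rw [← hode]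
    exact pow_ne_zero 2 (hneg u).ne
  have hd := (((hasDerivAt_Ppoly α θ _).comp u (hφ u).cos).sqrt hP).neg
  have hs : Real.sqrt (Ppoly α θ (Real.cos (φ u))) = -φ' u := by
    rw [← hode, Real.sqrt_sq_eq_abs, abs_of_neg (hneg u)]
  have hne := (hneg u).ne
  rw [hsqrt]
  refine hd.congr_deriv ?_
  simp only [Function.comp_apply, hs]
  field_simp
  ring

/-- On the curve `y₂ = c` of the surface one has
`y₁' = ((C² + G'²)/C)·cos φ·cosh A_c` and `y₃' = -((C² + G'²)/C)·sin φ·cosh A_c`. -/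
theorem statement_13 {α θ : ℝ} (hΩ : inOmega α θ) (hθ0 : θ ≠ 0)
    (φ φ' β G Gd : ℝ → ℝ)
    (hφ : ∀ u, HasDerivAt φ (φ' u) u) (hφ'c : Continuous φ')
    (hode : ∀ u, (φ' u) ^ 2 = Ppoly α θ (Real.cos (φ u)))
    (hφ0 : φ 0 = 0) (hφ'0 : φ' 0 ≤ 0)
    (hβ : ∀ u, HasDerivAt β (Ccoef α θ * Real.cos (φ u) ^ 2) u) (hβ0 : β 0 = 0)
    (hGd : ∀ u, Gd u =
      (Ccoef α θ ^ 2 * Real.cos (φ u) ^ 2 - Real.cos (2 * θ)) / (α - φ' u))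
    (hG : ∀ u, HasDerivAt G (Gd u) u) (hG0 : G 0 = 0)
    (c : ℝ) (Ac y₁ y₃ : ℝ → ℝ)
    (hAc : ∀ u, Ac u = α / Ccoef α θ * c + β u + α / Ccoef α θ * G u)
    (hy₁ : ∀ u, y₁ u = Gd u / α * Real.cos (φ u) * Real.sinh (Ac u)
      - Ccoef α θ / α * Real.sin (φ u) * Real.cosh (Ac u))
    (hy₃ : ∀ u, y₃ u = Ccoef α θ / α * (Gd u / α - 1) * Real.cos (φ u) * Real.cosh (Ac u)
      - 1 / α * (Ccoef α θ ^ 2 / α + Gd u) * Real.sin (φ u) * Real.sinh (Ac u)) :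
    ∀ u, HasDerivAt y₁
        ((Ccoef α θ ^ 2 + Gd u ^ 2) / Ccoef α θ * Real.cos (φ u) * Real.cosh (Ac u)) u ∧
      HasDerivAt y₃
        (-((Ccoef α θ ^ 2 + Gd u ^ 2) / Ccoef α θ * Real.sin (φ u) * Real.cosh (Ac u))) u := by
  have hα : α ≠ 0 := hΩ.1.ne'
  have hC := Ccoef_ne_zero hΩ hθ0
  have hne : ∀ u, φ' u ≠ 0 := fun u h => by
    have := hode u
    rw [h] at this
    linarith [Ppoly_pos hΩ (Real.cos_sq_le_one (φ u))]
  have hneg := neg_of_continuous_of_ne_zero hφ'c hne hφ'0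
  intro u
  have hD : α - φ' u ≠ 0 := (sub_pos.mpr ((hneg u).trans hΩ.1)).ne'
  have hP := hode u
  rw [Ppoly] at hP
  have hGcos : Gd u * Real.cos (φ u) ^ 2 = α + φ' u := by
    rw [hGd, div_mul_eq_mul_div, div_eq_iff hD]
    linear_combination hP
  have hGd' : HasDerivAt Gd
      (Real.sin (φ u) * Real.cos (φ u) * (Ccoef α θ ^ 2 + Gd u ^ 2)) u := by
    have h := ((((hφ u).cos.pow 2).const_mul (Ccoef α θ ^ 2)).sub_const
      (Real.cos (2 * θ))).div ((hasDerivAt_deriv_of_ode hφ hode hneg u).const_sub α) hD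
    rw [funext hGd]
    refine h.congr_deriv ?_
    simp only [Pi.pow_apply]
    field_simp
    linear_combination (Real.sin (φ u) * Real.cos (φ u) * Ccoef α θ ^ 2) * hP
  have hA : HasDerivAt Ac (Ccoef α θ * Real.cos (φ u) ^ 2 + α / Ccoef α θ * Gd u) u := by
    rw [funext hAc]
    exact ((hβ u).const_add _).add ((hG u).const_mul _)
  have hs := Real.sin_sq_add_cos_sq (φ u)
  generalize Ccoef α θ = C at *
  constructor
  · rw [funext hy₁]
    refine ((((hGd'.div_const α).mul (hφ u).cos).mul hA.sinh).sub
      (((hφ u).sin.const_mul (C / α)).mul hA.cosh)).congr_deriv ?_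
    simp only [Pi.mul_apply]
    generalize Gd u = g at *
    field_simp
    linear_combination (Real.sin (φ u) * C * g * Real.sinh (Ac u)
      + Real.cos (φ u) * C ^ 2 * Real.cosh (Ac u)) * hGcos
  · rw [funext hy₃]
    refine ((((((hGd'.div_const α).sub_const 1).const_mul (C / α)).mul (hφ u).cos).mul
      hA.cosh).sub ((((hGd'.const_add (C ^ 2 / α)).const_mul (1 / α)).mul (hφ u).sin).mul
      hA.sinh)).congr_deriv ?_
    simp only [Pi.mul_apply]
    generalize Gd u = g at *
    field_simp
    linear_combination (Real.sin (φ u) * C ^ 2 * (g - α) * Real.cosh (Ac u)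
      + C * Real.cos (φ u) * (C ^ 2 + α * g) * Real.sinh (Ac u)) * hGcos
      - C * Real.cos (φ u) * α * (C ^ 2 + g ^ 2) * Real.sinh (Ac u) * hs
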